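/- Let R be an associative ring with unit and let D be a resolving subcategory of mod R (i.e. D is closed under extensions and kernels of surjections and contains all finitely generated projective modules) with pd_D(D) < ∞. Then the cotorsion pair generated by D, namely (^{⊥1}(D^{⊥1}), D^{⊥1}), is a tilting cotorsion pair: there is a tilting module T ∈ Mod R with D^{⊥1} = T^⊥. -/

import Mathlib

noncomputable section

open CategoryTheory CategoryTheory.Limits Opposite DirectSum

universe u

namespace CotorsionDim

variable {R : Type u} [Ring R]

/-- `Ext^n_R(M,N) = 0`. -/
def ExtZero (M N : ModuleCat.{u} R) (n : ℕ) : Prop :=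
  IsZero (((Ext ℤ (ModuleCat.{u} R) n).obj (op M)).obj N)

/-- A pair of composable maps forms a short exact sequence `0 → A → B → C → 0`. -/
def IsSES {A B C : ModuleCat.{u} R} (f : A ⟶ B) (g : B ⟶ C) : Prop :=
  ∃ w : f ≫ g = 0, (CategoryTheory.ShortComplex.mk f g w).ShortExact

/-- relative projective dimension `pd_𝒳(M)` -/
def rpd (𝒳 : Set (ModuleCat.{u} R)) (M : ModuleCat.{u} R) : ℕ∞ :=
  sInf {n : ℕ∞ | ∀ j : ℕ, n < (j : ℕ∞) → ∀ X ∈ 𝒳, ExtZero M X j}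

/-- relative injective dimension `id_𝒳(M)` -/
def rid (𝒳 : Set (ModuleCat.{u} R)) (M : ModuleCat.{u} R) : ℕ∞ :=
  sInf {n : ℕ∞ | ∀ j : ℕ, n < (j : ℕ∞) → ∀ X ∈ 𝒳, ExtZero X M j}

/-- `pd_𝒳(𝒴)` -/
def rpdClass (𝒳 𝒴 : Set (ModuleCat.{u} R)) : ℕ∞ := ⨆ Y : 𝒴, rpd 𝒳 Y

/-- `id_𝒳(𝒴)` -/
def ridClass (𝒳 𝒴 : Set (ModuleCat.{u} R)) : ℕ∞ := ⨆ Y : 𝒴, rid 𝒳 Y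

/-- projective dimension -/
def pd (M : ModuleCat.{u} R) : ℕ∞ := rpd Set.univ M

/-- injective dimension -/
def idim (M : ModuleCat.{u} R) : ℕ∞ := rid Set.univ M

/-- `pd(𝒴)` -/
def pdClass (𝒴 : Set (ModuleCat.{u} R)) : ℕ∞ := ⨆ Y : 𝒴, pd Y.1

/-- `id(𝒴)` -/
def idClass (𝒴 : Set (ModuleCat.{u} R)) : ℕ∞ := ⨆ Y : 𝒴, idim Y.1

/-- `M` has an `𝒳`-resolution `0 → X_n → ⋯ → X_0 → M → 0` of length `n`. -/
def HasResLen (𝒳 : Set (ModuleCat.{u} R)) : ℕ → ModuleCat.{u} R → Prop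
  | 0, M => M ∈ 𝒳
  | n+1, M => ∃ (K X : ModuleCat.{u} R) (f : K ⟶ X) (g : X ⟶ M),
      X ∈ 𝒳 ∧ IsSES f g ∧ HasResLen 𝒳 n K

/-- `M` has an `𝒳`-coresolution `0 → M → X_0 → ⋯ → X_n → 0` of length `n`. -/
def HasCoresLen (𝒳 : Set (ModuleCat.{u} R)) : ℕ → ModuleCat.{u} R → Prop
  | 0, M => M ∈ 𝒳
  | n+1, M => ∃ (X C : ModuleCat.{u} R) (f : M ⟶ X) (g : X ⟶ C),
      X ∈ 𝒳 ∧ IsSES f g ∧ HasCoresLen 𝒳 n C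

/-- `resdim_𝒳(M)` -/
def resdim (𝒳 : Set (ModuleCat.{u} R)) (M : ModuleCat.{u} R) : ℕ∞ :=
  ⨅ n : {n : ℕ // HasResLen 𝒳 n M}, (n : ℕ∞)

/-- `coresdim_𝒳(M)` -/
def coresdim (𝒳 : Set (ModuleCat.{u} R)) (M : ModuleCat.{u} R) : ℕ∞ :=
  ⨅ n : {n : ℕ // HasCoresLen 𝒳 n M}, (n : ℕ∞)

/-- `resdim_𝒳(𝒴)` -/
def resdimClass (𝒳 𝒴 : Set (ModuleCat.{u} R)) : ℕ∞ := ⨆ Y : 𝒴, resdim 𝒳 Y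

/-- `coresdim_𝒳(𝒴)` -/
def coresdimClass (𝒳 𝒴 : Set (ModuleCat.{u} R)) : ℕ∞ := ⨆ Y : 𝒴, coresdim 𝒳 Y

/-- `𝒳^∧`, the class of modules with a finite `𝒳`-resolution. -/
def resClosure (𝒳 : Set (ModuleCat.{u} R)) : Set (ModuleCat.{u} R) :=
  {M | ∃ n, HasResLen 𝒳 n M}

/-- `𝒳^∨`, the class of modules with a finite `𝒳`-coresolution. -/
def coresClosure (𝒳 : Set (ModuleCat.{u} R)) : Set (ModuleCat.{u} R) :=
  {M | ∃ n, HasCoresLen 𝒳 n M}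

/-- `(𝒜, ℬ)` is a cotorsion pair. -/
def IsCotorsionPair (𝒜 ℬ : Set (ModuleCat.{u} R)) : Prop :=
  (∀ M, M ∈ 𝒜 ↔ ∀ B ∈ ℬ, ExtZero M B 1) ∧
  (∀ M, M ∈ ℬ ↔ ∀ A ∈ 𝒜, ExtZero A M 1)

/-- completeness of a cotorsion pair -/
def IsComplete (𝒜 ℬ : Set (ModuleCat.{u} R)) : Prop :=
  ∀ M : ModuleCat.{u} R,
    (∃ (B A : ModuleCat.{u} R) (f : B ⟶ A) (g : A ⟶ M), B ∈ ℬ ∧ A ∈ 𝒜 ∧ IsSES f g) ∧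
    (∃ (B A : ModuleCat.{u} R) (f : M ⟶ B) (g : B ⟶ A), B ∈ ℬ ∧ A ∈ 𝒜 ∧ IsSES f g)

/-- heredity of a cotorsion pair -/
def IsHereditary (𝒜 ℬ : Set (ModuleCat.{u} R)) : Prop :=
  ∀ i : ℕ, 1 ≤ i → ∀ A ∈ 𝒜, ∀ B ∈ ℬ, ExtZero A B i

variable (R)

/-- `𝒫`, the class of modules of finite projective dimension. -/
def P : Set (ModuleCat.{u} R) := {M | pd M < ⊤}

variable {R}

/-- `M` admits a projective resolution consisting of finitely generated projectives,
i.e. `M ∈ mod R`. -/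
def InmodR (M : ModuleCat.{u} R) : Prop :=
  ∃ K : ℕ → ModuleCat.{u} R, K 0 = M ∧ ∀ i : ℕ,
    ∃ (Q : ModuleCat.{u} R) (f : K (i+1) ⟶ Q) (g : Q ⟶ K i),
      Module.Finite R Q ∧ Projective Q ∧ IsSES f g

variable (R)

/-- `𝒫^{<∞} = 𝒫 ∩ mod R`. -/
def Pfin : Set (ModuleCat.{u} R) := {M | pd M < ⊤ ∧ InmodR M}

/-- the big finitistic dimension -/
def bigFindim : ℕ∞ := pdClass (P R)

/-- the little finitistic dimension -/
def littleFindim : ℕ∞ := pdClass (Pfin R)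

variable {R}

/-- `𝒳^{⊥₁}` -/
def rperp1 (𝒳 : Set (ModuleCat.{u} R)) : Set (ModuleCat.{u} R) :=
  {M | ∀ X ∈ 𝒳, ExtZero X M 1}

/-- `^{⊥₁}𝒳` -/
def lperp1 (𝒳 : Set (ModuleCat.{u} R)) : Set (ModuleCat.{u} R) :=
  {M | ∀ X ∈ 𝒳, ExtZero M X 1}

/-- `T^⊥ = {M : Ext^i(T,M) = 0 for all i > 0}` -/
def rperpAll (T : ModuleCat.{u} R) : Set (ModuleCat.{u} R) :=
  {M | ∀ i : ℕ, 0 < i → ExtZero T M i}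

/-- `Add T`: direct summands of arbitrary direct sums of copies of `T`. -/
def AddT (T : ModuleCat.{u} R) : Set (ModuleCat.{u} R) :=
  {M | ∃ (I : Type u) (s : M ⟶ ModuleCat.of R (I →₀ T)) (r : ModuleCat.of R (I →₀ T) ⟶ M),
    s ≫ r = 𝟙 M}

/-- `T` is a tilting module. -/
def IsTilting (T : ModuleCat.{u} R) : Prop :=
  pd T < ⊤ ∧
  (∀ i : ℕ, 0 < i → ∀ I : Type u, ExtZero T (ModuleCat.of R (I →₀ T)) i) ∧
  ∃ n, HasCoresLen (AddT T) n (ModuleCat.of R R)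


/-- `𝒳` is closed under arbitrary direct sums (coproducts). -/
def ClosedUnderCoproducts (𝒳 : Set (ModuleCat.{u} R)) : Prop :=
  ∀ (I : Type u) (f : I → ModuleCat.{u} R), (∀ i, f i ∈ 𝒳) →
    ModuleCat.of R (⨁ i, (f i : Type u)) ∈ 𝒳

/-- `𝒳` is closed under direct summands. -/
def ClosedUnderSummands (𝒳 : Set (ModuleCat.{u} R)) : Prop :=
  ∀ (M N : ModuleCat.{u} R) (s : M ⟶ N) (r : N ⟶ M), s ≫ r = 𝟙 M → N ∈ 𝒳 → M ∈ 𝒳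

variable {A B C : ModuleCat.{u} R} {f : A ⟶ B} {g : B ⟶ C}

lemma extZero_succ_iff (M N : ModuleCat.{u} R) (n : ℕ) :
    ExtZero M N (n + 1) ↔ Subsingleton (Abelian.Ext.{u} M N (n + 1)) := by
  let Q := projectiveResolution M
  have h₁ : ExtZero M N (n + 1) ↔ ∀ φ : Q.complex.X (n + 1) ⟶ N,
      Q.complex.d (n + 2) (n + 1) ≫ φ = 0 → ∃ ψ, Q.complex.d (n + 1) n ≫ ψ = φ := by
    rw [ExtZero, (Q.isoExt (R := ℤ) (n + 1) N).isZero_iff,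
      ← HomologicalComplex.exactAt_iff_isZero_homology,
      HomologicalComplex.exactAt_iff' _ n (n + 1) (n + 2) (by simp) (by simp),
      ShortComplex.moduleCat_exact_iff]
    exact Iff.rfl
  rw [h₁]
  constructor
  · intro h
    refine subsingleton_of_forall_eq 0 fun α => ?_
    obtain ⟨φ, hφ, rfl⟩ := Q.extMk_surjective α (n + 2) rfl
    exact (Q.extMk_eq_zero_iff φ _ _ hφ n rfl).2 (h φ hφ)
  · intro h φ hφ
    exact (Q.extMk_eq_zero_iff φ _ rfl hφ n rfl).1 (Subsingleton.elim _ _)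

lemma ExtZero.eq_zero {M N : ModuleCat.{u} R} {n : ℕ} (h : ExtZero M N (n + 1))
    (x : Abelian.Ext.{u} M N (n + 1)) : x = 0 :=
  have := (extZero_succ_iff M N n).1 h
  Subsingleton.elim _ _

lemma ExtZero.mk {M N : ModuleCat.{u} R} {n : ℕ}
    (h : ∀ x : Abelian.Ext.{u} M N (n + 1), x = 0) : ExtZero M N (n + 1) :=
  (extZero_succ_iff M N n).2 (subsingleton_of_forall_eq 0 h)

lemma ExtZero.of_projective (M N : ModuleCat.{u} R) [Projective M] (n : ℕ) :
    ExtZero M N (n + 1) :=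
  isZero_Ext_succ_of_projective M N n

lemma ExtZero.of_injective (M N : ModuleCat.{u} R) [Injective N] (n : ℕ) :
    ExtZero M N (n + 1) :=
  .mk Abelian.Ext.eq_zero_of_injective

lemma ExtZero.of_retract {M M' N : ModuleCat.{u} R} (r : Retract M M') {n : ℕ}
    (h : ExtZero M' N (n + 1)) : ExtZero M N (n + 1) := .mk fun x => by
  rw [← x.mk₀_id_comp, ← r.retract, ← Abelian.Ext.mk₀_comp_mk₀,
    Abelian.Ext.comp_assoc_of_second_deg_zero,
    h.eq_zero ((Abelian.Ext.mk₀ r.r).comp x (zero_add _)), Abelian.Ext.comp_zero]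

lemma IsSES.extZero_right (hS : IsSES f g) {N : ModuleCat.{u} R} {n : ℕ}
    (h₁ : ExtZero A N (n + 1)) (h₂ : ExtZero B N (n + 2)) : ExtZero C N (n + 2) := .mk fun x => by
  obtain ⟨w, hS⟩ := hS
  obtain ⟨y, rfl⟩ := Abelian.Ext.contravariant_sequence_exact₃ hS N x (h₂.eq_zero _)
    (show 1 + (n + 1) = n + 2 by omega)
  rw [h₁.eq_zero y, Abelian.Ext.comp_zero]

lemma IsSES.extZero_left (hS : IsSES f g) {N : ModuleCat.{u} R} {n : ℕ}
    (h₂ : ExtZero B N (n + 1)) (h₃ : ExtZero C N (n + 2)) : ExtZero A N (n + 1) := .mk fun x => by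
  obtain ⟨w, hS⟩ := hS
  obtain ⟨y, rfl⟩ := Abelian.Ext.contravariant_sequence_exact₁ hS N x
    (show 1 + (n + 1) = n + 2 by omega) (h₃.eq_zero _)
  rw [h₂.eq_zero y, Abelian.Ext.comp_zero]

lemma IsSES.extZero_middle (hS : IsSES f g) {N : ModuleCat.{u} R} {n : ℕ}
    (h₁ : ExtZero A N (n + 1)) (h₃ : ExtZero C N (n + 1)) : ExtZero B N (n + 1) := .mk fun x => by
  obtain ⟨w, hS⟩ := hS
  obtain ⟨y, rfl⟩ := Abelian.Ext.contravariant_sequence_exact₂ hS N x (h₁.eq_zero _)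
  rw [h₃.eq_zero y, Abelian.Ext.comp_zero]

lemma IsSES.extZero_to_left (hS : IsSES f g) {M : ModuleCat.{u} R} {n : ℕ}
    (h₃ : ExtZero M C (n + 1)) (h₂ : ExtZero M B (n + 2)) : ExtZero M A (n + 2) := .mk fun x => by
  obtain ⟨w, hS⟩ := hS
  obtain ⟨y, rfl⟩ := Abelian.Ext.covariant_sequence_exact₁ M hS x (h₂.eq_zero _) rfl
  rw [h₃.eq_zero y, Abelian.Ext.zero_comp]

lemma IsSES.extZero_to_right (hS : IsSES f g) {M : ModuleCat.{u} R} {n : ℕ}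
    (h₂ : ExtZero M B (n + 1)) (h₁ : ExtZero M A (n + 2)) : ExtZero M C (n + 1) := .mk fun x => by
  obtain ⟨w, hS⟩ := hS
  obtain ⟨y, rfl⟩ := Abelian.Ext.covariant_sequence_exact₃ M hS x rfl (h₁.eq_zero _)
  rw [h₂.eq_zero y, Abelian.Ext.zero_comp]

lemma IsSES.extZero_to_middle (hS : IsSES f g) {M : ModuleCat.{u} R} {n : ℕ}
    (h₁ : ExtZero M A (n + 1)) (h₃ : ExtZero M C (n + 1)) : ExtZero M B (n + 1) := .mk fun x => by
  obtain ⟨w, hS⟩ := hS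
  obtain ⟨y, rfl⟩ := Abelian.Ext.covariant_sequence_exact₂ M hS x (h₃.eq_zero _)
  rw [h₁.eq_zero y, Abelian.Ext.zero_comp]

lemma IsSES.exists_extension (hS : IsSES f g) {N : ModuleCat.{u} R} (h : ExtZero C N 1)
    (φ : A ⟶ N) : ∃ ψ : B ⟶ N, f ≫ ψ = φ := by
  obtain ⟨w, hS⟩ := hS
  obtain ⟨y, hy⟩ := Abelian.Ext.contravariant_sequence_exact₁ hS N (.mk₀ φ) (add_zero 1)
    (h.eq_zero _)
  obtain ⟨ψ, rfl⟩ := Abelian.Ext.homEquiv₀.symm.surjective y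
  exact ⟨ψ, Abelian.Ext.homEquiv₀.symm.injective (by simpa using hy)⟩

lemma IsSES.exists_lift (hS : IsSES f g) {M : ModuleCat.{u} R} (h : ExtZero M A 1)
    (φ : M ⟶ C) : ∃ ψ : M ⟶ B, ψ ≫ g = φ := by
  obtain ⟨w, hS⟩ := hS
  obtain ⟨y, hy⟩ := Abelian.Ext.covariant_sequence_exact₃ M hS (.mk₀ φ) (zero_add 1)
    (h.eq_zero _)
  obtain ⟨ψ, rfl⟩ := Abelian.Ext.homEquiv₀.symm.surjective y
  exact ⟨ψ, Abelian.Ext.homEquiv₀.symm.injective (by simpa using hy)⟩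

lemma IsSES.extZero_one_of_extension (hS : IsSES f g) {N : ModuleCat.{u} R}
    (h : ExtZero B N 1) (H : ∀ φ : A ⟶ N, ∃ ψ : B ⟶ N, f ≫ ψ = φ) : ExtZero C N 1 := .mk fun x => by
  obtain ⟨w, hS⟩ := hS
  obtain ⟨y, rfl⟩ := Abelian.Ext.contravariant_sequence_exact₃ hS N x (h.eq_zero _) (add_zero 1)
  obtain ⟨φ, rfl⟩ := Abelian.Ext.homEquiv₀.symm.surjective y
  obtain ⟨ψ, rfl⟩ := H φ
  have := hS.extClass_comp_assoc (.mk₀ ψ) (h := add_zero 1)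
  simpa using this

lemma IsSES.extZero_one_of_lift (hS : IsSES f g) {M : ModuleCat.{u} R}
    (h : ExtZero M B 1) (H : ∀ φ : M ⟶ C, ∃ ψ : M ⟶ B, ψ ≫ g = φ) : ExtZero M A 1 := .mk fun x => by
  obtain ⟨w, hS⟩ := hS
  obtain ⟨y, rfl⟩ := Abelian.Ext.covariant_sequence_exact₁ M hS x (h.eq_zero _) (zero_add 1)
  obtain ⟨φ, rfl⟩ := Abelian.Ext.homEquiv₀.symm.surjective y
  obtain ⟨ψ, rfl⟩ := H φ
  have := hS.comp_extClass
  simp only [Abelian.Ext.homEquiv₀_symm_apply, ← Abelian.Ext.mk₀_comp_mk₀] at *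
  rw [Abelian.Ext.comp_assoc _ _ _ (zero_add 0) (zero_add 1) (by simp)]
  erw [this]
  simp

lemma isSES_of_mono {A B : ModuleCat.{u} R} (f : A ⟶ B) [Mono f] : IsSES f (cokernel.π f) :=
  ⟨cokernel.condition f, { exact := ShortComplex.exact_cokernel f }⟩

lemma isSES_subtype {B C : ModuleCat.{u} R} (g : B ⟶ C) (hg : Function.Surjective g) :
    IsSES (ModuleCat.ofHom (LinearMap.ker g.hom).subtype) g := by
  have : Epi g := (ModuleCat.epi_iff_surjective g).2 hg
  have : Mono (ModuleCat.ofHom (LinearMap.ker g.hom).subtype) :=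
    (ModuleCat.mono_iff_injective _).2 Subtype.val_injective
  refine ⟨by ext x; exact x.2, { exact := ?_ }⟩
  rw [ShortComplex.moduleCat_exact_iff]
  exact fun x hx => ⟨⟨x, hx⟩, rfl⟩

lemma isSES_biprod (A B : ModuleCat.{u} R) :
    IsSES (biprod.inl : A ⟶ A ⊞ B) (biprod.snd : A ⊞ B ⟶ B) :=
  ⟨biprod.inl_snd, (ShortComplex.Splitting.ofHasBinaryBiproduct A B).shortExact⟩

lemma HasCoresLen.mono {𝒳 𝒴 : Set (ModuleCat.{u} R)} (h : 𝒳 ⊆ 𝒴) {n : ℕ} {M : ModuleCat.{u} R}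
    (hM : HasCoresLen 𝒳 n M) : HasCoresLen 𝒴 n M := by
  induction n generalizing M with
  | zero => exact h hM
  | succ n ih =>
    obtain ⟨X, C, f, g, hX, hS, hC⟩ := hM
    exact ⟨X, C, f, g, h hX, hS, ih hC⟩

lemma HasCoresLen.extZero {T M N : ModuleCat.{u} R} {n : ℕ}
    (hM : HasCoresLen {Y | Nonempty (Retract Y T)} n M) (hN : N ∈ rperpAll T) (j : ℕ) :
    ExtZero M N (j + 1) := by
  induction n generalizing M j with
  | zero =>
    obtain ⟨r⟩ := hM
    exact .of_retract r (hN _ (by omega))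
  | succ n ih =>
    obtain ⟨X, C, f, g, ⟨r⟩, hS, hC⟩ := hM
    exact hS.extZero_left (.of_retract r (hN _ (by omega))) (ih hC (j + 1))

lemma exists_preenvelope_of_hasCoresLen {T M : ModuleCat.{u} R} {n : ℕ}
    (hM : HasCoresLen {Y | Nonempty (Retract Y T)} n M) :
    ∃ f : M ⟶ T, ∀ {N : ModuleCat.{u} R}, N ∈ rperpAll T → ∀ φ : M ⟶ N, ∃ ψ, f ≫ ψ = φ := by
  cases n with
  | zero =>
    obtain ⟨r⟩ := hM
    exact ⟨r.i, fun _ φ => ⟨r.r ≫ φ, by simp⟩⟩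
  | succ n =>
    obtain ⟨X, C, f, g, ⟨r⟩, hS, hC⟩ := hM
    refine ⟨f ≫ r.i, fun hN φ => ?_⟩
    obtain ⟨ψ, rfl⟩ := hS.exists_extension (hC.extZero hN 0) φ
    exact ⟨r.r ≫ ψ, by simp⟩

lemma hasSmallObjectArgument_ofHoms_of_mono {C : Type*} [Category.{u} C] [Abelian C]
    [IsGrothendieckAbelian.{u} C] {ι : Type u} {X Y : ι → C} (f : ∀ i, X i ⟶ Y i)
    [∀ i, Mono (f i)] :
    MorphismProperty.HasSmallObjectArgument.{u} (MorphismProperty.ofHoms f) := by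
  obtain ⟨κ, hκ', hκ⟩ := HasCardinalLT.exists_regular_cardinal_forall.{u} fun i => Subobject (X i)
  have : Fact κ.IsRegular := ⟨hκ'⟩
  have : Nonempty κ.ord.ToType := by simpa using hκ'.ne_zero
  have := WellFoundedLT.toOrderBot κ.ord.ToType
  have hle : MorphismProperty.ofHoms f ≤ MorphismProperty.monomorphisms C := by
    rintro _ _ _ ⟨i⟩
    exact inferInstanceAs (Mono _)
  exact ⟨κ, inferInstance, inferInstance,
    { preservesColimit {A B X Y} i hi g hg := by
        let hg' : (MorphismProperty.monomorphisms C).TransfiniteCompositionOfShape κ.ord.ToType g :=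
          { toTransfiniteCompositionOfShape := hg.toTransfiniteCompositionOfShape
            map_mem j hj := by
              have := (hg.attachCells j hj).pushouts_coproducts
              simp only [MorphismProperty.ofHoms_homFamily] at this
              refine (?_ : _ ≤ MorphismProperty.monomorphisms C) _ this
              simpa only [MorphismProperty.pushouts_le_iff, MorphismProperty.coproducts_le_iff] }
        have (j j' : κ.ord.ToType) (φ : j ⟶ j') : Mono (hg'.F.map φ) := hg'.mem_map φ
        obtain ⟨k⟩ := hi
        exact IsGrothendieckAbelian.preservesColimit_coyoneda_obj_of_mono (Y := hg'.F) (κ := κ)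
          (hκ k) }⟩

/-- A resolving subcategory of `mod R`. -/
structure IsResolving (𝒟 : Set (ModuleCat.{u} R)) : Prop where
  inmodR : ∀ M ∈ 𝒟, InmodR M
  projective_mem : ∀ M : ModuleCat.{u} R, Projective M → Module.Finite R M → M ∈ 𝒟
  kernel_mem : ∀ (A B C : ModuleCat.{u} R) (f : A ⟶ B) (g : B ⟶ C),
    IsSES f g → B ∈ 𝒟 → C ∈ 𝒟 → A ∈ 𝒟

lemma InmodR.finite {M : ModuleCat.{u} R} (h : InmodR M) : Module.Finite R M := by
  obtain ⟨K, rfl, hK⟩ := h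
  obtain ⟨Q, f, g, hfin, -, w, hS⟩ := hK 0
  have := hS.epi_g
  exact Module.Finite.of_surjective g.hom ((ModuleCat.epi_iff_surjective g).1 this)

instance projective_of_pi_fin (m : ℕ) : Projective (ModuleCat.of R (Fin m → R)) :=
  ModuleCat.projective_of_free (Pi.basisFun R (Fin m))

/-- The submodules of finite free modules that occur as the kernel of a surjection onto a
member of `𝒟`. -/
structure Presentation (𝒟 : Set (ModuleCat.{u} R)) where
  rank : ℕ
  kernel : Submodule R (Fin rank → R)
  exists_isSES : ∃ X ∈ 𝒟, ∃ g : ModuleCat.of R (Fin rank → R) ⟶ X,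
    IsSES (ModuleCat.ofHom kernel.subtype) g

/-- The inclusion of the module of relations into the finite free module. -/
def Presentation.ι {𝒟 : Set (ModuleCat.{u} R)} (p : Presentation 𝒟) :
    ModuleCat.of R p.kernel ⟶ ModuleCat.of R (Fin p.rank → R) :=
  ModuleCat.ofHom p.kernel.subtype

instance Presentation.mono_ι {𝒟 : Set (ModuleCat.{u} R)} (p : Presentation 𝒟) : Mono p.ι :=
  (ModuleCat.mono_iff_injective _).2 Subtype.val_injective

namespace IsResolving

variable {𝒟 : Set (ModuleCat.{u} R)}

lemma pi_fin_mem (h : IsResolving 𝒟) (m : ℕ) : ModuleCat.of R (Fin m → R) ∈ 𝒟 :=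
  h.projective_mem _ inferInstance (inferInstanceAs (Module.Finite R (Fin m → R)))

lemma exists_presentation (h : IsResolving 𝒟) {X : ModuleCat.{u} R} (hX : X ∈ 𝒟) :
    ∃ (p : Presentation 𝒟) (g : ModuleCat.of R (Fin p.rank → R) ⟶ X), IsSES p.ι g := by
  have := (h.inmodR X hX).finite
  obtain ⟨m, g, hg⟩ := Module.Finite.exists_fin' R X
  exact ⟨⟨m, _, X, hX, ModuleCat.ofHom g, isSES_subtype _ hg⟩, _, isSES_subtype _ hg⟩

lemma kernel_mem_of_presentation (h : IsResolving 𝒟) (p : Presentation 𝒟) :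
    ModuleCat.of R p.kernel ∈ 𝒟 := by
  obtain ⟨X, hX, g, hS⟩ := p.exists_isSES
  exact h.kernel_mem _ _ _ _ _ hS (h.pi_fin_mem _) hX

lemma mem_rperp1_iff (h : IsResolving 𝒟) (N : ModuleCat.{u} R) :
    N ∈ rperp1 𝒟 ↔ ∀ (p : Presentation 𝒟) (φ : ModuleCat.of R p.kernel ⟶ N),
      ∃ ψ : ModuleCat.of R (Fin p.rank → R) ⟶ N, p.ι ≫ ψ = φ := by
  constructor
  · intro hN p
    obtain ⟨X, hX, g, hS⟩ := p.exists_isSES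
    exact IsSES.exists_extension hS (hN X hX)
  · intro H X hX
    obtain ⟨p, g, hS⟩ := h.exists_presentation hX
    exact hS.extZero_one_of_extension (.of_projective _ _ 0) (H p)

lemma extZero_of_mem_rperp1 (h : IsResolving 𝒟) {N : ModuleCat.{u} R} (hN : N ∈ rperp1 𝒟)
    (n : ℕ) : ∀ X ∈ 𝒟, ExtZero X N (n + 1) := by
  induction n with
  | zero => exact hN
  | succ n ih =>
    intro X hX
    obtain ⟨p, g, hS⟩ := h.exists_presentation hX
    exact hS.extZero_right (ih _ (h.kernel_mem_of_presentation p)) (.of_projective _ _ _)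

lemma rperp1_of_isSES (h : IsResolving 𝒟) {A B C : ModuleCat.{u} R} {f : A ⟶ B} {g : B ⟶ C}
    (hS : IsSES f g) (hA : A ∈ rperp1 𝒟) (hB : B ∈ rperp1 𝒟) : C ∈ rperp1 𝒟 := fun X hX =>
  hS.extZero_to_right (hB X hX) (h.extZero_of_mem_rperp1 hA 1 X hX)

lemma finsupp_mem_rperp1 (h : IsResolving 𝒟) {T : ModuleCat.{u} R} (hT : T ∈ rperp1 𝒟)
    (I : Type u) : ModuleCat.of R (I →₀ T) ∈ rperp1 𝒟 := by
  classical
  rw [h.mem_rperp1_iff] at hT ⊢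
  intro p φ
  have hfin := (h.inmodR _ (h.kernel_mem_of_presentation p)).finite
  obtain ⟨S, hS⟩ := hfin.fg_top
  let s : Finset I := S.biUnion fun x => (φ.hom x).support
  have hs : ∀ x, φ.hom x ∈ Finsupp.supported T R (s : Set I) := by
    have : (⊤ : Submodule R p.kernel) ≤ (Finsupp.supported T R (s : Set I)).comap φ.hom := by
      rw [← hS, Submodule.span_le]
      intro x hx
      rw [SetLike.mem_coe, Submodule.mem_comap, Finsupp.mem_supported]
      exact_mod_cast Finset.subset_biUnion_of_mem (fun x => (φ.hom x).support) hx
    exact fun x => this trivial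
  choose ψ hψ using fun i => hT p (φ ≫ ModuleCat.ofHom (Finsupp.lapply i))
  refine ⟨ModuleCat.ofHom (∑ i ∈ s, Finsupp.lsingle i ∘ₗ (ψ i).hom), ?_⟩
  ext x i
  have hi : (ψ i).hom x.1 = φ.hom x i := LinearMap.congr_fun (congrArg ModuleCat.Hom.hom (hψ i)) x
  have key : (∑ j ∈ s, Finsupp.single j ((ψ j).hom x.1)) i = φ.hom x i := by
    rw [Finsupp.finsetSum_apply]
    simp only [Finsupp.single_apply, Finset.sum_ite_eq', hi]
    split_ifs with his
    · rfl
    · by_contra hne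
      exact his ((Finsupp.mem_supported R _).1 (hs x) (Finsupp.mem_support_iff.2 (Ne.symm hne)))
  simpa [Presentation.ι] using key

lemma exists_extZero_of_rpdClass_lt_top (h : IsResolving 𝒟) (hpd : rpdClass 𝒟 𝒟 < ⊤) :
    ∃ n : ℕ, ∀ X ∈ 𝒟, ∀ N : ModuleCat.{u} R, ∀ j, n ≤ j → ExtZero X N (j + 1) := by
  obtain ⟨n, hn⟩ := ENat.ne_top_iff_exists.1 hpd.ne
  refine ⟨n, fun X hX => ?_⟩
  have hX' : ∀ X' ∈ 𝒟, ∀ j, n ≤ j → ExtZero X X' (j + 1) := by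
    intro X' hX' j hj
    have : rpd 𝒟 X < ((j + 1 : ℕ) : ℕ∞) := calc
      rpd 𝒟 X ≤ rpdClass 𝒟 𝒟 := le_iSup (fun Y : 𝒟 => rpd 𝒟 Y) ⟨X, hX⟩
      _ = n := hn.symm
      _ < _ := by exact_mod_cast Nat.lt_succ_of_le hj
    obtain ⟨m, hm, hlt⟩ := sInf_lt_iff.1 this
    exact hm _ hlt X' hX'
  clear hn
  induction n generalizing X with
  | zero =>
    obtain ⟨p, g, hS⟩ := h.exists_presentation hX
    obtain ⟨s, hs⟩ := hS.exists_lift (hX' _ (h.kernel_mem_of_presentation p) 0 le_rfl) (𝟙 X)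
    have : Projective X := Retract.projective ⟨s, g, hs⟩
    exact fun N j _ => .of_projective X N j
  | succ n ih =>
    obtain ⟨p, g, hS⟩ := h.exists_presentation hX
    intro N j hj
    obtain ⟨j, rfl⟩ : ∃ k, j = k + 1 := ⟨j - 1, by omega⟩
    refine hS.extZero_right (ih _ (h.kernel_mem_of_presentation p) ?_ N j (by omega))
      (.of_projective _ _ _)
    exact fun X' hX'' i hi => hS.extZero_left (.of_projective _ _ _) (hX' X' hX'' _ (by omega))

open ZeroObject in
lemma exists_rperp1_preenvelope (h : IsResolving 𝒟) (M : ModuleCat.{u} R) :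
    ∃ (B C : ModuleCat.{u} R) (f : M ⟶ B) (g : B ⟶ C),
      B ∈ rperp1 𝒟 ∧ C ∈ lperp1 (rperp1 𝒟) ∧ IsSES f g := by
  let I : MorphismProperty (ModuleCat.{u} R) := .ofHoms fun p : Presentation 𝒟 => p.ι
  have : MorphismProperty.HasSmallObjectArgument.{u} I :=
    hasSmallObjectArgument_ofHoms_of_mono _
  let F := MorphismProperty.factorizationData I.rlp.llp I.rlp (0 : M ⟶ 0)
  have hB : F.Z ∈ rperp1 𝒟 := by
    rw [h.mem_rperp1_iff]
    intro p φ
    have := F.hp _ (MorphismProperty.ofHoms.mk p)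
    have sq : CommSq φ p.ι F.p 0 := ⟨(isZero_zero _).eq_of_tgt _ _⟩
    exact ⟨sq.lift, sq.fac_left⟩
  have hrlp : ∀ {A B C : ModuleCat.{u} R} {f : A ⟶ B} {g : B ⟶ C}, IsSES f g →
      A ∈ rperp1 𝒟 → I.rlp g := by
    rintro A B C f g ⟨w, hS⟩ hA _ _ _ ⟨p⟩
    refine ⟨fun {a b} sq => ?_⟩
    have := hS.epi_g
    have := hS.mono_f
    let l := Projective.factorThru b g
    obtain ⟨k, hk⟩ : ∃ k, k ≫ f = a - p.ι ≫ l :=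
      ⟨hS.exact.lift (a - p.ι ≫ l) (by simp [l, sq.w]), hS.exact.lift_f _ _⟩
    obtain ⟨e, he⟩ := (h.mem_rperp1_iff A).1 hA p k
    refine ⟨⟨⟨l + e ≫ f, ?_, ?_⟩⟩⟩
    · rw [Preadditive.comp_add, reassoc_of% he, hk]; abel
    · simp [l, w]
  have hmono : Mono F.i := by
    have := F.hi _ (hrlp (isSES_of_mono (𝟙 (Injective.under M))) fun X _ => .of_injective _ _ 0)
    have sq : CommSq (Injective.ι M) F.i (cokernel.π (𝟙 (Injective.under M))) 0 := ⟨by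
      rw [comp_zero, ← Category.id_comp (cokernel.π _), cokernel.condition, comp_zero]⟩
    have : Mono (F.i ≫ sq.lift) := by rw [sq.fac_left]; infer_instance
    exact mono_of_mono F.i sq.lift
  refine ⟨F.Z, cokernel F.i, F.i, cokernel.π F.i, hB, fun N hN => ?_, isSES_of_mono _⟩
  have hS := isSES_of_mono (Injective.ι N)
  refine hS.extZero_one_of_lift (.of_injective _ _ 0) fun φ => ?_
  have := F.hi _ (hrlp hS hN)
  have sq : CommSq 0 F.i (cokernel.π (Injective.ι N)) (cokernel.π F.i ≫ φ) := ⟨by simp⟩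
  refine ⟨cokernel.desc F.i sq.lift sq.fac_left, ?_⟩
  rw [← cancel_epi (cokernel.π F.i), cokernel.π_desc_assoc, sq.fac_right]

lemma extZero_of_mem_lperp1 (h : IsResolving 𝒟) {A : ModuleCat.{u} R}
    (hA : A ∈ lperp1 (rperp1 𝒟)) (n : ℕ) : ∀ N ∈ rperp1 𝒟, ExtZero A N (n + 1) := by
  induction n with
  | zero => exact hA
  | succ n ih =>
    intro N hN
    have hS := isSES_of_mono (Injective.ι N)
    exact hS.extZero_to_left
      (ih _ (h.rperp1_of_isSES hS hN fun X _ => .of_injective _ _ 0)) (.of_injective _ _ _)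

lemma extZero_of_mem_lperp1_of_le (h : IsResolving 𝒟) {A : ModuleCat.{u} R}
    (hA : A ∈ lperp1 (rperp1 𝒟)) (n : ℕ) {N : ModuleCat.{u} R}
    (hN : ∀ X ∈ 𝒟, ∀ j, n ≤ j → ExtZero X N (j + 1)) (j : ℕ) (hj : n ≤ j) :
    ExtZero A N (j + 1) := by
  induction n generalizing N j with
  | zero => exact h.extZero_of_mem_lperp1 hA j N fun X hX => hN X hX 0 le_rfl
  | succ n ih =>
    obtain ⟨j, rfl⟩ : ∃ k, j = k + 1 := ⟨j - 1, by omega⟩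
    have hS := isSES_of_mono (Injective.ι N)
    refine hS.extZero_to_left (ih (fun X hX i hi => ?_) j (by omega)) (.of_injective _ _ _)
    exact hS.extZero_to_right (.of_injective _ _ _) (hN X hX (i + 1) (by omega))

lemma exists_hasCoresLen (h : IsResolving 𝒟) (n : ℕ) {M : ModuleCat.{u} R}
    (hM : M ∈ lperp1 (rperp1 𝒟)) (hn : ∀ X ∈ 𝒟, ∀ j, n ≤ j → ExtZero X M (j + 1)) :
    ∃ T ∈ lperp1 (rperp1 𝒟), T ∈ rperp1 𝒟 ∧ HasCoresLen {Y | Nonempty (Retract Y T)} n M := by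
  induction n generalizing M with
  | zero => exact ⟨M, hM, fun X hX => hn X hX 0 le_rfl, ⟨Retract.refl M⟩⟩
  | succ n ih =>
    obtain ⟨B, C, f, g, hB, hC, hS⟩ := h.exists_rperp1_preenvelope M
    obtain ⟨T, hT, hT', hres⟩ := ih hC fun X hX j hj =>
      hS.extZero_to_right (h.extZero_of_mem_rperp1 hB j X hX) (hn X hX (j + 1) (by omega))
    have hB' : B ∈ lperp1 (rperp1 𝒟) := fun N hN => hS.extZero_middle (hM N hN) (hC N hN)
    refine ⟨T ⊞ B, fun N hN => (isSES_biprod T B).extZero_middle (hT N hN) (hB' N hN),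
      fun X hX => (isSES_biprod T B).extZero_to_middle (hT' X hX) (hB X hX),
      B, C, f, g, ⟨⟨biprod.inr, biprod.snd, biprod.inr_snd⟩⟩, hS, hres.mono ?_⟩
    exact fun Y ⟨r⟩ => ⟨r.trans ⟨biprod.inl, biprod.fst, biprod.inl_fst⟩⟩

lemma rperpAll_subset (h : IsResolving 𝒟) {T : ModuleCat.{u} R} (hT : T ∈ rperp1 𝒟) {k n : ℕ}
    (hres : HasCoresLen {Y | Nonempty (Retract Y T)} k (ModuleCat.of R R))
    (hn : ∀ X ∈ 𝒟, ∀ N : ModuleCat.{u} R, ∀ j, n ≤ j → ExtZero X N (j + 1))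
    (hTT : ∀ I : Type u, ∀ j, ExtZero T (ModuleCat.of R (I →₀ T)) (j + 1)) :
    rperpAll T ⊆ rperp1 𝒟 := by
  obtain ⟨f, hf⟩ := exists_preenvelope_of_hasCoresLen hres
  suffices H : ∀ i, ∀ M ∈ rperpAll T, ∀ X ∈ 𝒟, ∀ j, n ≤ j + i → ExtZero X M (j + 1) from
    fun M hM X hX => H n M hM X hX 0 (by omega)
  intro i
  induction i with
  | zero => exact fun M _ X hX j hj => hn X hX M j hj
  | succ i ih =>
    intro M hM X hX j hj
    let g : ModuleCat.of R ((T ⟶ M) →₀ T) ⟶ M :=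
      ModuleCat.ofHom (Finsupp.lsum ℕ fun φ : T ⟶ M => φ.hom)
    have hg (φ : T ⟶ M) : ModuleCat.ofHom (Finsupp.lsingle φ) ≫ g = φ := by
      ext x
      simp [g]
    have hsurj : Function.Surjective g := by
      intro m
      obtain ⟨φ, hφ⟩ := hf hM (ModuleCat.ofHom (LinearMap.toSpanSingleton R M m))
      refine ⟨Finsupp.single φ (f (1 : R)), ?_⟩
      have := LinearMap.congr_fun (congrArg ModuleCat.Hom.hom hφ) (1 : R)
      simpa [g] using this
    have hS := isSES_subtype g hsurj
    have hL : ModuleCat.of R (LinearMap.ker g.hom) ∈ rperpAll T := by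
      rintro (_ | _ | j) hj
      · omega
      · exact hS.extZero_one_of_lift (hTT _ 0) fun φ => ⟨_, hg φ⟩
      · exact hS.extZero_to_left (hM (j + 1) (by omega)) (hTT _ _)
    exact hS.extZero_to_right (h.extZero_of_mem_rperp1 (h.finsupp_mem_rperp1 hT _) j X hX)
      (ih _ hL X hX (j + 1) (by omega))

end IsResolving

/-- Corollary 3.3: a resolving subcategory `𝒟` of `mod R` with `pd_𝒟(𝒟) < ∞`
generates a tilting cotorsion pair. -/
theorem stmt11 {R : Type u} [Ring R] (𝒟 : Set (ModuleCat.{u} R))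
    (hmod : ∀ M ∈ 𝒟, InmodR M)
    (hproj : ∀ M : ModuleCat.{u} R, Projective M → Module.Finite R M → M ∈ 𝒟)
    (hext : ∀ (A B C : ModuleCat.{u} R) (f : A ⟶ B) (g : B ⟶ C),
      IsSES f g → A ∈ 𝒟 → C ∈ 𝒟 → B ∈ 𝒟)
    (hker : ∀ (A B C : ModuleCat.{u} R) (f : A ⟶ B) (g : B ⟶ C),
      IsSES f g → B ∈ 𝒟 → C ∈ 𝒟 → A ∈ 𝒟)
    (hpd : rpdClass 𝒟 𝒟 < ⊤) :
    ∃ T : ModuleCat.{u} R, IsTilting T ∧ rperp1 𝒟 = rperpAll T := by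
  have h : IsResolving 𝒟 := ⟨hmod, hproj, hker⟩
  obtain ⟨n, hn⟩ := h.exists_extZero_of_rpdClass_lt_top hpd
  have : Projective (ModuleCat.of R R) := ModuleCat.projective_of_free
    (Module.Basis.singleton PUnit.{1} R)
  obtain ⟨T, hT, hT', hres⟩ := h.exists_hasCoresLen n (M := ModuleCat.of R R)
    (fun N _ => .of_projective _ _ 0) fun X hX => hn X hX _
  have hTT (I : Type u) (j : ℕ) : ExtZero T (ModuleCat.of R (I →₀ T)) (j + 1) :=
    h.extZero_of_mem_lperp1 hT j _ (h.finsupp_mem_rperp1 hT' I)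
  refine ⟨T, ⟨?_, ?_, n, hres.mono ?_⟩, Set.Subset.antisymm ?_ (h.rperpAll_subset hT' hres hn hTT)⟩
  · refine lt_of_le_of_lt (sInf_le (a := (n : ℕ∞)) ?_) (ENat.natCast_lt_top n)
    rintro (_ | j) hj N -
    · simp at hj
    · exact h.extZero_of_mem_lperp1_of_le hT n (fun X hX => hn X hX N) j
        (Nat.le_of_lt_succ (by exact_mod_cast hj))
  · rintro (_ | i) hi I
    · omega
    · exact hTT I i
  · rintro Y ⟨r⟩
    have e : ModuleCat.ofHom (Finsupp.lsingle PUnit.unit) ≫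
        ModuleCat.ofHom (Finsupp.lapply (R := R) (M := T) PUnit.unit) = 𝟙 T := by
      ext x
      simp
    exact ⟨PUnit, r.i ≫ ModuleCat.ofHom (Finsupp.lsingle PUnit.unit),
      ModuleCat.ofHom (Finsupp.lapply PUnit.unit) ≫ r.r, by
        rw [Category.assoc, reassoc_of% e, r.retract]⟩
  · rintro M hM (_ | i) hi
    · omega
    · exact h.extZero_of_mem_lperp1 hT i M hM

end CotorsionDim
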